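/- Assume E[X]>0, P(Z₁=0|Z₀=1)>0, that E[e^{−sX}]<∞ for some s>0, and Assumption A1: there exists γ>0 such that Q(0)<1−γ almost surely and E[|X|]<∞. Then ρ>0, i.e. P_{z₀}(Zₙ=z₀) decays exponentially fast in n. -/

import Mathlib

open MeasureTheory ProbabilityTheory Filter Topology

noncomputable section

/-- `q` is a probability mass function on `ℕ`. -/
def IsPMF (q : ℕ → ℝ) : Prop := (∀ k, 0 ≤ q k) ∧ (∑' k, q k) = 1

/-- Mean `m_q` of a mass function on `ℕ`. -/
def pmfMean (q : ℕ → ℝ) : ℝ := ∑' k : ℕ, (k : ℝ) * q k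

/-- `X = log m_Q`. -/
def envX (q : ℕ → ℝ) : ℝ := Real.log (pmfMean q)

/-- Probability generating function of `q`. -/
def pgf (q : ℕ → ℝ) (s : ℝ) : ℝ := ∑' k, q k * s ^ k

/-- Derivative `f'` of the probability generating function of `q`. -/
def dpgf (q : ℕ → ℝ) (s : ℝ) : ℝ := ∑' k : ℕ, (k : ℝ) * q k * s ^ (k - 1)

/-- Second factorial moment `f''(1)` of `q`. -/
def pgf2 (q : ℕ → ℝ) : ℝ := ∑' k : ℕ, (k : ℝ) * ((k : ℝ) - 1) * q k

/-- Convolution of two mass functions on `ℕ`. -/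
def conv (q r : ℕ → ℝ) (k : ℕ) : ℝ := ∑ j ∈ Finset.range (k + 1), q j * r (k - j)

/-- `z`-fold convolution power `q^{*z}`. -/
def convPow (q : ℕ → ℝ) : ℕ → ℕ → ℝ
  | 0 => fun k => if k = 0 then 1 else 0
  | z + 1 => conv q (convPow q z)

/-- Quenched `n`-step transition probabilities of the branching process in the (varying)
environment `e`, where `e i` is the offspring distribution of generation `i + 1`:
`qtrans e n k j = P(Z_n = j | Z_0 = k, environment e)`. -/
def qtrans (e : ℕ → ℕ → ℝ) : ℕ → ℕ → ℕ → ℝ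
  | 0, k, j => if j = k then 1 else 0
  | n + 1, k, j => ∑' i : ℕ, qtrans e n k i * convPow (e n) i j

/-- Composition `f_{i,n} = f_{i+1} ∘ ⋯ ∘ f_n` of generating functions, where `e m` is the
offspring distribution `Q_{m+1}`. -/
def Fcomp (e : ℕ → ℕ → ℝ) (i n : ℕ) (s : ℝ) : ℝ :=
  (List.range (n - i)).foldr (fun m t => pgf (e (i + m)) t) s

/-- Extension of a finite environment to an infinite one (by a trivial environment). -/
def extEnv (n : ℕ) (e : Fin n → ℕ → ℝ) : ℕ → ℕ → ℝ := fun i =>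
  if h : i < n then e ⟨i, h⟩ else fun k => if k = 1 then 1 else 0

/-- Law of the first `n` generations of an i.i.d. environment with marginal `ν`. -/
def envPi (ν : Measure (ℕ → ℝ)) [SigmaFinite ν] (n : ℕ) :
    Measure (Fin n → ℕ → ℝ) :=
  Measure.pi fun _ : Fin n => ν

/-- Annealed probability `P_k(Z_n = j)` of the BPRE whose environment is i.i.d. with
marginal law `ν`. -/
def aP (ν : Measure (ℕ → ℝ)) [SigmaFinite ν] (n k j : ℕ) : ℝ :=
  ∫ e, qtrans (extEnv n e) n k j ∂(envPi ν n)

/-- The set `𝓘 = {j ≥ 1 : P(Q(j) > 0, Q(0) > 0) > 0}`. -/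
def Iset (ν : Measure (ℕ → ℝ)) : Set ℕ :=
  {j | 1 ≤ j ∧ 0 < ν {q | 0 < q j ∧ 0 < q 0}}

/-- The set `Cl(𝓘)` of states reachable from `𝓘`. -/
def clI (ν : Measure (ℕ → ℝ)) [SigmaFinite ν] : Set ℕ :=
  {k | 1 ≤ k ∧ ∃ n, ∃ j ∈ Iset ν, 0 < aP ν n j k}

/-- The set `Cl({z})` of states reachable from `z`. -/
def clz (ν : Measure (ℕ → ℝ)) [SigmaFinite ν] (z : ℕ) : Set ℕ :=
  {k | 1 ≤ k ∧ ∃ n, 0 < aP ν n z k}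

/-- The spine (Geiger) expectation
`E[Q_n(z₀) f_{0,n}(0)^{z₀-1} ∏_{i=1}^{n-1} f_i'(f_{i,n}(0))]`. -/
def geigerExp (ν : Measure (ℕ → ℝ)) [SigmaFinite ν] (z₀ n : ℕ) : ℝ :=
  ∫ e, (extEnv n e (n - 1)) z₀ * (Fcomp (extEnv n e) 0 n 0) ^ (z₀ - 1) *
      ∏ i ∈ Finset.Icc 1 (n - 1), dpgf (extEnv n e (i - 1)) (Fcomp (extEnv n e) i n 0)
    ∂(envPi ν n)

/-- `Λ(0) = - log inf_{λ ≥ 0} E[e^{-λ X}]`, the rate function of `S` at `0`. -/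
def Lam0 (ν : Measure (ℕ → ℝ)) : ℝ :=
  - Real.log (sInf ((fun l : ℝ => ∫ q, Real.exp (-(l * envX q)) ∂ν) '' {l : ℝ | 0 ≤ l}))

/-- Truncated standardized second moment `ξ_q(a)`. -/
def xi (q : ℕ → ℝ) (a : ℕ) : ℝ :=
  (∑' y : ℕ, if a ≤ y then (y : ℝ) ^ 2 * q y else 0) / (pmfMean q) ^ 2

/-- Assumption A2 : the random walk is non-lattice and a truncated moment condition holds. -/
def AssumptionA2 (ν : Measure (ℕ → ℝ)) : Prop :=
  (∀ r : ℝ, 0 < r → ν {q | ∃ m : ℤ, envX q = r * m} < 1) ∧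
  ∃ ε : ℝ, 0 < ε ∧ ∃ a : ℕ, ∀ x : ℝ, 0 < x →
    IntegrableOn (fun q => Real.log (max (xi q a) 1) ^ ((2 : ℝ) + ε))
      {q | -x < envX q} ν

/-- `q` has a linear fractional generating function with mean `m = pmfMean q` and
second derivative `b` at `1`. -/
def IsLF (q : ℕ → ℝ) : Prop :=
  0 < pmfMean q ∧ ∃ b : ℝ, 0 ≤ b ∧ ∀ s ∈ Set.Icc (0 : ℝ) 1,
    pgf q s = 1 - (1 - s) / ((pmfMean q)⁻¹ + b * ((pmfMean q) ^ 2)⁻¹ * (1 - s) / 2)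

lemma IsPMF.summable {q : ℕ → ℝ} (h : IsPMF q) : Summable q := by
  by_contra hc
  have := tsum_eq_zero_of_not_summable hc
  rw [h.2] at this
  exact one_ne_zero this

lemma convPow_nonneg {q : ℕ → ℝ} (h : ∀ k, 0 ≤ q k) : ∀ i j, 0 ≤ convPow q i j := by
  intro i
  induction i with
  | zero => intro j; simp only [convPow]; split_ifs <;> norm_num
  | succ i ih =>
    intro j
    simp only [convPow, conv]
    exact Finset.sum_nonneg fun a _ => mul_nonneg (h a) (ih _)

lemma convPow_measurable (i j : ℕ) : Measurable (fun q : ℕ → ℝ => convPow q i j) := by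
  induction i generalizing j with
  | zero => simp only [convPow]; exact measurable_const
  | succ i ih =>
    simp only [convPow, conv]
    exact Finset.measurable_fun_sum _ fun a _ => (measurable_pi_apply a).mul (ih _)

lemma IsPMF.summable_pgf {q : ℕ → ℝ} (h : IsPMF q) {u : ℝ} (hu0 : 0 ≤ u) (hu1 : u ≤ 1) :
    Summable (fun j => q j * u ^ j) :=
  Summable.of_nonneg_of_le (fun j => mul_nonneg (h.1 j) (pow_nonneg hu0 j))
    (fun j => mul_le_of_le_one_right (h.1 j) (pow_le_one₀ hu0 hu1)) h.summable

lemma convPow_hasSum {q : ℕ → ℝ} (h : IsPMF q) {u : ℝ} (hu0 : 0 ≤ u) (hu1 : u ≤ 1) (i : ℕ) :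
    HasSum (fun j => convPow q i j * u ^ j) (pgf q u ^ i) := by
  induction i with
  | zero =>
    simp only [convPow, pow_zero]
    convert hasSum_ite_eq (0 : ℕ) (1 : ℝ) using 2 with j
    by_cases hj : j = 0 <;> simp [hj]
  | succ i ih =>
    have hs := h.summable_pgf hu0 hu1
    have h1 : Summable fun j => ‖q j * u ^ j‖ := hs.norm
    have h2 : Summable fun j => ‖convPow q i j * u ^ j‖ := ih.summable.norm
    have h3 := hasSum_sum_range_mul_of_summable_norm h1 h2
    rw [ih.tsum_eq] at h3
    rw [pow_succ']
    have h4 : (fun j => convPow q (i + 1) j * u ^ j) = fun n => ∑ k ∈ Finset.range (n + 1),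
        q k * u ^ k * (convPow q i (n - k) * u ^ (n - k)) := by
     funext n
     simp only [convPow, conv, Finset.sum_mul]
     refine Finset.sum_congr rfl fun k hk => ?_
     have : k + (n - k) = n := by have := Finset.mem_range.1 hk; omega
     have e : u ^ n = u ^ k * u ^ (n - k) := by rw [← pow_add, this]
     rw [e]; ring
    rw [h4]; exact h3

lemma convPow_hasSum_one {q : ℕ → ℝ} (h : IsPMF q) (i : ℕ) :
    HasSum (fun j => convPow q i j) 1 := by
  have := convPow_hasSum h zero_le_one le_rfl i
  simpa [pgf, h.2] using this

lemma convPow_zero_right (q : ℕ → ℝ) (i : ℕ) : convPow q i 0 = q 0 ^ i := by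
  induction i with
  | zero => simp [convPow]
  | succ i ih => simp [convPow, conv, ih, pow_succ']

lemma convPow_pos {q : ℕ → ℝ} (h : ∀ k, 0 ≤ q k) {z : ℕ} (hz : 1 ≤ z) (hqz : 0 < q z)
    (hq0 : 0 < q 0) : 0 < convPow q z z := by
  obtain ⟨w, rfl⟩ : ∃ w, z = w + 1 := ⟨z - 1, by omega⟩
  simp only [convPow, conv]
  refine Finset.sum_pos' (fun a _ => mul_nonneg (h a) (convPow_nonneg h _ _))
    ⟨w + 1, by simp, ?_⟩
  rw [Nat.sub_self, convPow_zero_right]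
  positivity

open scoped ENNReal

/-- annealed one-step matrix -/
def kap (ν : Measure (ℕ → ℝ)) (i j : ℕ) : ℝ≥0∞ := ∫⁻ q, ENNReal.ofReal (convPow q i j) ∂ν

/-- annealed n-step matrix -/
def kapN (ν : Measure (ℕ → ℝ)) : ℕ → ℕ → ℕ → ℝ≥0∞
  | 0, k, j => if j = k then 1 else 0
  | n + 1, k, j => ∑' i : ℕ, kapN ν n k i * kap ν i j

/-- quenched transition in extended reals -/
def eqt (e : ℕ → ℕ → ℝ) : ℕ → ℕ → ℕ → ℝ≥0∞
  | 0, k, j => if j = k then 1 else 0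
  | n + 1, k, j => ∑' i : ℕ, eqt e n k i * ENNReal.ofReal (convPow (e n) i j)

lemma eqt_congr {e e' : ℕ → ℕ → ℝ} (n : ℕ) (h : ∀ i < n, e i = e' i) (k j : ℕ) :
    eqt e n k j = eqt e' n k j := by
  induction n generalizing j with
  | zero => rfl
  | succ n ih =>
    simp only [eqt]
    refine tsum_congr fun i => ?_
    rw [ih (fun i hi => h i (by omega)), h n (by omega)]

lemma tsum_ofReal_convPow {q : ℕ → ℝ} (h : IsPMF q) (i : ℕ) :
    ∑' j, ENNReal.ofReal (convPow q i j) = 1 := by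
  rw [← ENNReal.ofReal_tsum_of_nonneg (convPow_nonneg h.1 i) (convPow_hasSum_one h i).summable,
    (convPow_hasSum_one h i).tsum_eq, ENNReal.ofReal_one]

lemma eqt_tsum {e : ℕ → ℕ → ℝ} (n : ℕ) (h : ∀ i < n, IsPMF (e i)) (k : ℕ) :
    ∑' j, eqt e n k j = 1 := by
  induction n with
  | zero => simp [eqt]
  | succ n ih =>
    simp only [eqt]
    rw [ENNReal.tsum_comm]
    simp only [ENNReal.tsum_mul_left, tsum_ofReal_convPow (h n (by omega)), mul_one]
    exact ih fun i hi => h i (by omega)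

lemma eqt_le_one {e : ℕ → ℕ → ℝ} (n : ℕ) (h : ∀ i < n, IsPMF (e i)) (k j : ℕ) :
    eqt e n k j ≤ 1 := by
  rw [← eqt_tsum n h k]; exact ENNReal.le_tsum j

lemma qtrans_eq {e : ℕ → ℕ → ℝ} (n : ℕ) (h : ∀ i < n, IsPMF (e i)) (k j : ℕ) :
    qtrans e n k j = (eqt e n k j).toReal := by
  induction n generalizing j with
  | zero => simp only [qtrans, eqt]; split_ifs <;> simp
  | succ n ih =>
    have h' : ∀ i < n, IsPMF (e i) := fun i hi => h i (by omega)
    simp only [qtrans, eqt]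
    rw [ENNReal.tsum_toReal_eq]
    · refine tsum_congr fun i => ?_
      rw [ENNReal.toReal_mul, ← ih h',
        ENNReal.toReal_ofReal (convPow_nonneg (h n (by omega)).1 _ _)]
    · intro i
      exact ENNReal.mul_ne_top (ne_top_of_le_ne_top ENNReal.one_ne_top (eqt_le_one n h' k i))
        ENNReal.ofReal_ne_top

lemma extEnv_measurable (n i : ℕ) : Measurable (fun e : Fin n → ℕ → ℝ => extEnv n e i) := by
  unfold extEnv
  by_cases h : i < n
  · simp only [h, dite_true]; exact measurable_pi_apply _
  · simp only [h, dite_false]; exact measurable_const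

lemma eqt_measurable (N n k j : ℕ) :
    Measurable (fun e : Fin N → ℕ → ℝ => eqt (extEnv N e) n k j) := by
  induction n generalizing j with
  | zero => simp only [eqt]; exact measurable_const
  | succ n ih =>
    simp only [eqt]
    refine Measurable.tsum fun i => (ih i).mul ?_
    exact ((convPow_measurable i j).comp (extEnv_measurable N n)).ennreal_ofReal

lemma lintegral_eqt (ν : Measure (ℕ → ℝ)) [IsProbabilityMeasure ν] (n k j : ℕ) :
    ∫⁻ e, eqt (extEnv n e) n k j ∂(envPi ν n) = kapN ν n k j := by
  induction n generalizing j with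
  | zero =>
    have : IsProbabilityMeasure (envPi ν 0) := by unfold envPi; infer_instance
    simp only [eqt, kapN, lintegral_const, measure_univ, mul_one]
  | succ n ih =>
    have mp := measurePreserving_piFinSuccAbove (fun _ : Fin (n + 1) => ν) (Fin.last n)
    have key : ∀ e : Fin (n + 1) → ℕ → ℝ, eqt (extEnv (n + 1) e) (n + 1) k j =
        (fun p : (ℕ → ℝ) × (Fin n → ℕ → ℝ) =>
          ∑' i : ℕ, eqt (extEnv n p.2) n k i * ENNReal.ofReal (convPow p.1 i j))
          (MeasurableEquiv.piFinSuccAbove (fun _ : Fin (n + 1) => (ℕ → ℝ)) (Fin.last n) e) := by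
      intro e
      simp only [eqt]
      refine tsum_congr fun i => ?_
      congr 1
      · refine eqt_congr n (fun i hi => ?_) k _
        simp only [extEnv, hi, Nat.lt_succ_of_lt hi, dite_true]
        simp [MeasurableEquiv.piFinSuccAbove, Fin.insertNthEquiv]
        rfl
      · simp [extEnv, MeasurableEquiv.piFinSuccAbove, Fin.insertNthEquiv]
        rfl
    have hm : ∀ i, Measurable (fun p : (ℕ → ℝ) × (Fin n → ℕ → ℝ) =>
        eqt (extEnv n p.2) n k i * ENNReal.ofReal (convPow p.1 i j)) := fun i =>
      ((eqt_measurable n n k i).comp measurable_snd).mul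
        ((convPow_measurable i j).comp measurable_fst).ennreal_ofReal
    simp only [key]
    unfold envPi
    rw [mp.lintegral_comp (f := fun p : (ℕ → ℝ) × (Fin n → ℕ → ℝ) =>
          ∑' i : ℕ, eqt (extEnv n p.2) n k i * ENNReal.ofReal (convPow p.1 i j))
          (Measurable.tsum hm)]
    rw [lintegral_tsum fun i => (hm i).aemeasurable]
    simp only [kapN]
    refine tsum_congr fun i => ?_
    have : SFinite (envPi ν n) := by unfold envPi; infer_instance
    rw [← ih i, kap, mul_comm (lintegral _ _)]
    rw [← lintegral_prod_mul (convPow_measurable i j).ennreal_ofReal.aemeasurable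
      (eqt_measurable n n k i).aemeasurable]
    refine lintegral_congr fun p => mul_comm _ _

lemma aP_eq (ν : Measure (ℕ → ℝ)) [IsProbabilityMeasure ν] (hpmf : ∀ᵐ q ∂ν, IsPMF q)
    (n k j : ℕ) : aP ν n k j = (kapN ν n k j).toReal := by
  have hae : ∀ᵐ e ∂(envPi ν n), ∀ i < n, IsPMF (extEnv n e i) := by
    have : ∀ᵐ e ∂(envPi ν n), ∀ i : Fin n, IsPMF (e i) := by
      rw [ae_all_iff]
      intro i
      exact (Measure.tendsto_eval_ae_ae (μ := fun _ : Fin n => ν) (i := i)).eventually hpmf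
    filter_upwards [this] with e he i hi
    simp only [extEnv, hi, dite_true]
    exact he _
  unfold aP
  rw [← lintegral_eqt, ← integral_toReal (eqt_measurable n n k j).aemeasurable]
  · refine integral_congr_ae ?_
    filter_upwards [hae] with e he
    exact qtrans_eq n he k j
  · filter_upwards [hae] with e he
    exact (eqt_le_one n he k j).trans_lt ENNReal.one_lt_top

/-- weight -/
def Wt (s : ℝ) (j : ℕ) : ℝ := if j = 0 then 0 else (j : ℝ) ^ (-s)

/-- rescaled one-step inverse moment -/
def Phi (s : ℝ) (k : ℕ) (q : ℕ → ℝ) : ℝ := (k : ℝ) ^ s * ∑' j, convPow q k j * Wt s j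

lemma Wt_nonneg (s : ℝ) (j : ℕ) : 0 ≤ Wt s j := by
  unfold Wt; split_ifs
  · exact le_rfl
  · positivity

lemma Wt_le_one {s : ℝ} (hs : 0 < s) (j : ℕ) : Wt s j ≤ 1 := by
  unfold Wt; split_ifs with h
  · exact zero_le_one
  · exact Real.rpow_le_one_of_one_le_of_nonpos (by exact_mod_cast Nat.one_le_iff_ne_zero.2 h)
      (by linarith)

lemma Phi_measurable (s : ℝ) (k : ℕ) : Measurable (Phi s k) := by
  unfold Phi
  exact measurable_const.mul (Measurable.tsum fun j => (convPow_measurable k j).mul_const _)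

lemma summable_Wt {q : ℕ → ℝ} (h : IsPMF q) {s : ℝ} (hs : 0 < s) (k : ℕ) :
    Summable (fun j => convPow q k j * Wt s j) :=
  Summable.of_nonneg_of_le (fun j => mul_nonneg (convPow_nonneg h.1 k j) (Wt_nonneg s j))
    (fun j => mul_le_of_le_one_right (convPow_nonneg h.1 k j) (Wt_le_one hs j))
    (convPow_hasSum_one h k).summable

lemma Phi_nonneg {q : ℕ → ℝ} (h : IsPMF q) (s : ℝ) (k : ℕ) : 0 ≤ Phi s k q :=
  mul_nonneg (by positivity)
    (tsum_nonneg fun j => mul_nonneg (convPow_nonneg h.1 k j) (Wt_nonneg s j))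

lemma pgf_nonneg {q : ℕ → ℝ} (h : IsPMF q) {u : ℝ} (hu : 0 ≤ u) : 0 ≤ pgf q u :=
  tsum_nonneg fun j => mul_nonneg (h.1 j) (pow_nonneg hu j)

lemma Wt_le {s a u : ℝ} (hs : 0 < s) (ha : 0 < a) (hu0 : 0 < u) (hu1 : u ≤ 1) {k : ℕ}
    (hk : 1 ≤ k) (j : ℕ) : Wt s j ≤ (a * k) ^ (-s) + u ^ j * (u ^ (-a)) ^ k := by
  have hk' : (0 : ℝ) < k := by exact_mod_cast hk
  by_cases hj : j = 0
  · simp only [Wt, hj, if_true]; positivity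
  have hj' : (1 : ℝ) ≤ j := by exact_mod_cast Nat.one_le_iff_ne_zero.2 hj
  by_cases hjk : a * k ≤ j
  · have : Wt s j ≤ (a * k) ^ (-s) := by
      simp only [Wt, hj, if_false]
      exact Real.rpow_le_rpow_of_nonpos (by positivity) hjk (by linarith)
    have : 0 ≤ u ^ j * (u ^ (-a)) ^ k := by positivity
    linarith
  · have h1 : u ^ j * (u ^ (-a)) ^ k = u ^ ((j : ℝ) - a * k) := by
      rw [← Real.rpow_natCast u j, ← Real.rpow_natCast _ k, ← Real.rpow_mul hu0.le,
        ← Real.rpow_add hu0]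
      ring_nf
    have h2 : 1 ≤ u ^ ((j : ℝ) - a * k) :=
      Real.one_le_rpow_of_pos_of_le_one_of_nonpos hu0 hu1 (by push Not at hjk; linarith)
    have := Wt_le_one hs j
    have : 0 ≤ (a * (k : ℝ)) ^ (-s) := by positivity
    linarith

lemma Phi_le {q : ℕ → ℝ} (h : IsPMF q) {s a u : ℝ} (hs : 0 < s) (ha : 0 < a) (hu0 : 0 < u)
    (hu1 : u ≤ 1) {k : ℕ} (hk : 1 ≤ k) :
    Phi s k q ≤ a ^ (-s) + (k : ℝ) ^ s * (u ^ (-a) * pgf q u) ^ k := by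
  have hk' : (0 : ℝ) < k := by exact_mod_cast hk
  have h1 : HasSum (fun j => convPow q k j * ((a * k) ^ (-s)) +
      (convPow q k j * u ^ j) * (u ^ (-a)) ^ k)
      (1 * ((a * k) ^ (-s)) + pgf q u ^ k * (u ^ (-a)) ^ k) :=
    ((convPow_hasSum_one h k).mul_right _).add ((convPow_hasSum h hu0.le hu1 k).mul_right _)
  have h2 : ∑' j, convPow q k j * Wt s j ≤
      1 * ((a * k) ^ (-s)) + pgf q u ^ k * (u ^ (-a)) ^ k := by
    rw [← h1.tsum_eq]
    refine (summable_Wt h hs k).tsum_le_tsum (fun j => ?_) h1.summable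
    have := mul_le_mul_of_nonneg_left (Wt_le hs ha hu0 hu1 hk j) (convPow_nonneg h.1 k j)
    linarith
  have h3 : (k : ℝ) ^ s * (a * k) ^ (-s) = a ^ (-s) := by
    rw [Real.mul_rpow ha.le hk'.le, mul_left_comm, ← Real.rpow_add hk']
    simp
  calc Phi s k q ≤ (k : ℝ) ^ s * (1 * ((a * k) ^ (-s)) + pgf q u ^ k * (u ^ (-a)) ^ k) :=
        mul_le_mul_of_nonneg_left h2 (by positivity)
    _ = _ := by rw [one_mul, mul_add, h3, mul_pow]; ring

lemma pgf_le {q : ℕ → ℝ} (h : IsPMF q) {u : ℝ} (hu0 : 0 ≤ u) (hu1 : u ≤ 1) (N : ℕ) :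
    pgf q u ≤ 1 - ∑ j ∈ Finset.range N, q j * (1 - u ^ j) := by
  have h1 : HasSum (fun j => q j - q j * u ^ j) (1 - pgf q u) := by
    have := h.summable.hasSum
    rw [h.2] at this
    exact this.sub (h.summable_pgf hu0 hu1).hasSum
  have h2 := sum_le_hasSum (Finset.range N) (fun j _ => ?_) h1
  · have : ∑ j ∈ Finset.range N, q j * (1 - u ^ j) = ∑ j ∈ Finset.range N, (q j - q j * u ^ j) :=
      Finset.sum_congr rfl fun j _ => by ring
    linarith
  · have := mul_le_of_le_one_right (h.1 j) (pow_le_one₀ (n := j) hu0 hu1)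
    linarith

lemma exp_neg_le' {x : ℝ} (hx : 0 ≤ x) : x - x ^ 2 ≤ 1 - Real.exp (-x) := by
  have h1 : 1 + x ≤ Real.exp x := by linarith [Real.add_one_le_exp x]
  have h2 : Real.exp (-x) ≤ 1 / (1 + x) := by
    rw [Real.exp_neg, ← one_div]
    exact one_div_le_one_div_of_le (by linarith) h1
  have h3 : 1 / (1 + x) ≤ 1 - x + x ^ 2 := by
    rw [div_le_iff₀ (by linarith)]
    nlinarith [pow_nonneg hx 3]
  linarith

lemma exists_u {q : ℕ → ℝ} (h : IsPMF q) {a : ℝ} {N : ℕ}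
    (haN : a < ∑ j ∈ Finset.range N, (j : ℝ) * q j) :
    ∃ u : ℝ, 0 < u ∧ u ≤ 1 ∧ u ^ (-a) * pgf q u < 1 := by
  set M := ∑ j ∈ Finset.range N, (j : ℝ) * q j with hM
  set C := ∑ j ∈ Finset.range N, q j * (j : ℝ) ^ 2 with hC
  have hC0 : 0 ≤ C := Finset.sum_nonneg fun j _ => mul_nonneg (h.1 j) (by positivity)
  set t := (M - a) / (C + 1) with ht
  have ht0 : 0 < t := div_pos (by linarith) (by linarith)
  have htC : t * C < M - a := by
    have : t * (C + 1) = M - a := by rw [ht]; field_simp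
    nlinarith
  refine ⟨Real.exp (-t), Real.exp_pos _, Real.exp_le_one_iff.2 (by linarith), ?_⟩
  have e1 : Real.exp (-t) ^ (-a) = Real.exp (t * a) := by
    rw [← Real.exp_mul]; ring_nf
  have e2 := pgf_le h (Real.exp_pos (-t)).le (Real.exp_le_one_iff.2 (by linarith)) N
  set A := ∑ j ∈ Finset.range N, q j * (1 - Real.exp (-t) ^ j) with hA
  have e3 : t * M - t ^ 2 * C ≤ A := by
    rw [hM, hC, hA, Finset.mul_sum, Finset.mul_sum, ← Finset.sum_sub_distrib]
    refine Finset.sum_le_sum fun j _ => ?_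
    have e4 : Real.exp (-t) ^ j = Real.exp (-(j * t)) := by
      rw [← Real.exp_nat_mul]; ring_nf
    rw [e4]
    have := mul_le_mul_of_nonneg_left (exp_neg_le' (x := j * t) (by positivity)) (h.1 j)
    linarith
  rw [e1]
  calc Real.exp (t * a) * pgf q (Real.exp (-t)) ≤ Real.exp (t * a) * Real.exp (-A) := by
        refine mul_le_mul_of_nonneg_left ?_ (Real.exp_pos _).le
        linarith [Real.add_one_le_exp (-A)]
    _ = Real.exp (t * a - A) := by rw [← Real.exp_add]; ring_nf
    _ < 1 := by
        rw [Real.exp_lt_one_iff]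
        nlinarith

lemma tendsto_aux (s : ℝ) {η : ℝ} (h0 : 0 ≤ η) (h1 : η < 1) :
    Tendsto (fun k : ℕ => (k : ℝ) ^ s * η ^ k) atTop (𝓝 0) := by
  refine tendsto_of_tendsto_of_tendsto_of_le_of_le' tendsto_const_nhds
    (tendsto_pow_const_mul_const_pow_of_lt_one ⌈s⌉₊ h0 h1) ?_ ?_
  · exact Eventually.of_forall fun k => by positivity
  · filter_upwards [eventually_ge_atTop 1] with k hk
    refine mul_le_mul_of_nonneg_right ?_ (by positivity)
    rw [← Real.rpow_natCast]
    exact Real.rpow_le_rpow_of_exponent_le (by exact_mod_cast hk) (Nat.le_ceil s)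

lemma pgf_half {q : ℕ → ℝ} (h : IsPMF q) {γ : ℝ} (hq : q 0 < 1 - γ) :
    pgf q (1 / 2) ≤ 1 - γ / 2 := by
  have h1 : HasSum (fun j => q j * (1 / 2) + (if j = 0 then q 0 / 2 else 0))
      (1 * (1 / 2) + q 0 / 2) := by
    have := h.summable.hasSum
    rw [h.2] at this
    exact (this.mul_right _).add (hasSum_ite_eq 0 _)
  have h2 : pgf q (1 / 2) ≤ 1 * (1 / 2) + q 0 / 2 := by
    rw [← h1.tsum_eq]
    refine (h.summable_pgf (by norm_num) (by norm_num)).tsum_le_tsum (fun j => ?_) h1.summable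
    by_cases hj : j = 0
    · subst hj; simp; linarith
    · simp only [hj, if_false, add_zero]
      refine mul_le_mul_of_nonneg_left ?_ (h.1 j)
      calc (1 / 2 : ℝ) ^ j ≤ (1 / 2) ^ 1 :=
            pow_le_pow_of_le_one (by norm_num) (by norm_num) (Nat.one_le_iff_ne_zero.2 hj)
        _ = _ := pow_one _
  linarith

lemma Phi_bdd {γ s : ℝ} (hγ : 0 < γ) (hγ1 : γ ≤ 1) (hs : 0 < s) :
    ∃ C : ℝ, ∀ q : ℕ → ℝ, IsPMF q → q 0 < 1 - γ → ∀ k : ℕ, 1 ≤ k → Phi s k q ≤ C := by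
  set a := Real.logb 2 (1 + γ / 2) with ha
  have ha0 : 0 < a := Real.logb_pos (by norm_num) (by linarith)
  have e1 : (1 / 2 : ℝ) ^ (-a) = 1 + γ / 2 := by
    rw [one_div, Real.inv_rpow (by norm_num), Real.rpow_neg (by norm_num), inv_inv, ha,
      Real.rpow_logb (by norm_num) (by norm_num) (by linarith)]
  obtain ⟨B, hB⟩ := (tendsto_aux s (η := 1 - γ ^ 2 / 4) (by nlinarith)
    (by nlinarith)).bddAbove_range
  refine ⟨a ^ (-s) + B, fun q h hq k hk => ?_⟩
  refine (Phi_le h hs ha0 (u := 1 / 2) (by norm_num) (by norm_num) hk).trans ?_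
  refine add_le_add_right ?_ _
  refine le_trans ?_ (hB ⟨k, rfl⟩)
  refine mul_le_mul_of_nonneg_left ?_ (by positivity)
  rw [e1]
  have := pgf_nonneg h (u := 1 / 2) (by norm_num)
  refine pow_le_pow_left₀ (by positivity) ?_ _
  have := pgf_half h hq
  nlinarith

lemma exists_N {q : ℕ → ℝ} (h : IsPMF q) (hq : q 0 < 1) {a : ℝ}
    (haX : a < Real.exp (envX q)) : ∃ N : ℕ, a < ∑ j ∈ Finset.range N, (j : ℝ) * q j := by
  have hnn : ∀ j : ℕ, 0 ≤ (j : ℝ) * q j := fun j => mul_nonneg (by positivity) (h.1 j)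
  by_cases hsum : Summable (fun j : ℕ => (j : ℝ) * q j)
  · have hpos : 0 < pmfMean q := by
      have hex : ∃ j, j ≠ 0 ∧ q j ≠ 0 := by
        by_contra hc
        push Not at hc
        have := h.2
        rw [tsum_eq_single 0 hc] at this
        linarith
      obtain ⟨j, hj, hqj⟩ := hex
      refine hsum.tsum_pos hnn j (mul_pos ?_ (lt_of_le_of_ne (h.1 j) hqj.symm))
      exact_mod_cast Nat.pos_of_ne_zero hj
    rw [envX, Real.exp_log hpos] at haX
    exact (hsum.hasSum.tendsto_sum_nat.eventually (lt_mem_nhds haX)).exists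
  · exact (((not_summable_iff_tendsto_nat_atTop_of_nonneg hnn).1 hsum).eventually_gt_atTop a).exists

lemma Phi_eventually {q : ℕ → ℝ} (h : IsPMF q) (hq : q 0 < 1) {s c : ℝ} (hs : 0 < s)
    (hc : Real.exp (-(s * envX q)) < c) : ∀ᶠ k : ℕ in atTop, Phi s k q < c := by
  have hc0 : 0 < c := (Real.exp_pos _).trans hc
  set X := envX q with hX
  have hL : -(s * X) < Real.log c := (Real.lt_log_iff_exp_lt hc0).2 hc
  set y := -(Real.log c - s * X) / (2 * s) with hy
  have hys : y * (2 * s) = -(Real.log c - s * X) := by rw [hy]; field_simp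
  have hyX : y < X := by
    by_contra hcon
    push Not at hcon
    nlinarith
  obtain ⟨N, hN⟩ := exists_N h hq (a := Real.exp y) (Real.exp_lt_exp.2 hyX)
  obtain ⟨u, hu0, hu1, hu⟩ := exists_u h hN
  have e1 : Real.exp y ^ (-s) < c := by
    rw [← Real.exp_mul, ← Real.lt_log_iff_exp_lt hc0]
    nlinarith
  have ht := (tendsto_aux s (η := u ^ (-Real.exp y) * pgf q u)
    (mul_nonneg (by positivity) (pgf_nonneg h hu0.le)) hu).const_add (Real.exp y ^ (-s))
  rw [add_zero] at ht
  filter_upwards [ht.eventually (gt_mem_nhds e1), eventually_ge_atTop 1] with k hk hk1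
  exact (Phi_le h hs (Real.exp_pos y) hu0 hu1 hk1).trans_lt hk

lemma exists_s {ν : Measure (ℕ → ℝ)} [IsProbabilityMeasure ν]
    (hXint : Integrable envX ν) (hEX : 0 < ∫ q, envX q ∂ν)
    (hexp : ∃ s : ℝ, 0 < s ∧ Integrable (fun q => Real.exp (-(s * envX q))) ν) :
    ∃ s : ℝ, 0 < s ∧ Integrable (fun q => Real.exp (-(s * envX q))) ν ∧
      ∫ q, Real.exp (-(s * envX q)) ∂ν < 1 := by
  obtain ⟨s₀, hs₀, hint⟩ := hexp
  let t : ℕ → ℝ := fun n => 1 / ((n : ℝ) + 1)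
  have ht0 : ∀ n, 0 < t n := fun n => by positivity
  have ht1 : ∀ n, t n ≤ 1 := fun n => by
    rw [div_le_one (by positivity)]; linarith [(Nat.cast_nonneg n : (0 : ℝ) ≤ n)]
  have htlim : Tendsto t atTop (𝓝 0) := tendsto_one_div_add_atTop_nhds_zero_nat
  have hconv : ∀ n (x : ℝ), Real.exp (-(t n * s₀ * x)) ≤ 1 - t n + t n * Real.exp (-(s₀ * x)) := by
    intro n x
    have := convexOn_exp.2 (Set.mem_univ 0) (Set.mem_univ (-(s₀ * x)))
      (show 0 ≤ 1 - t n by linarith [ht1 n]) (ht0 n).le (by ring)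
    simp only [smul_eq_mul, mul_zero, zero_add, Real.exp_zero, mul_one] at this
    have e : t n * -(s₀ * x) = -(t n * s₀ * x) := by ring
    rw [e] at this
    exact this
  have hm : ∀ n, AEStronglyMeasurable (fun q => Real.exp (-(t n * s₀ * envX q))) ν := fun n =>
    Real.continuous_exp.comp_aestronglyMeasurable (hXint.1.const_mul _).neg
  have hi : ∀ n, Integrable (fun q => Real.exp (-(t n * s₀ * envX q))) ν := by
    intro n
    refine Integrable.mono' ((integrable_const (1 - t n)).add (hint.const_mul (t n))) (hm n) ?_
    filter_upwards with q
    rw [Real.norm_eq_abs, Real.abs_exp]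
    exact hconv n _
  have hlim : Tendsto (fun n => ∫ q, (Real.exp (-(t n * s₀ * envX q)) - 1) / t n ∂ν) atTop
      (𝓝 (∫ q, -(s₀ * envX q) ∂ν)) := by
    refine tendsto_integral_of_dominated_convergence
      (fun q => Real.exp (-(s₀ * envX q)) + 1 + s₀ * |envX q|) (fun n => ?_) ?_ (fun n => ?_) ?_
    · exact ((hi n).sub (integrable_const 1)).div_const _ |>.1
    · exact (hint.add (integrable_const 1)).add (hXint.abs.const_mul _)
    · filter_upwards with q
      set x := envX q
      rw [Real.norm_eq_abs, abs_le]
      have h1 := Real.add_one_le_exp (-(t n * s₀ * x))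
      have h2 := hconv n x
      have h3 := Real.exp_pos (-(s₀ * x))
      have h4 : 0 ≤ s₀ * |x| := by positivity
      have h5 : s₀ * x ≤ s₀ * |x| := mul_le_mul_of_nonneg_left (le_abs_self x) hs₀.le
      constructor
      · rw [le_div_iff₀ (ht0 n)]
        nlinarith [ht0 n]
      · rw [div_le_iff₀ (ht0 n)]
        nlinarith [ht0 n]
    · filter_upwards with q
      set x := envX q
      have hd : HasDerivAt (fun r : ℝ => Real.exp (-(r * s₀ * x))) (-(s₀ * x)) 0 := by
        have : HasDerivAt (fun r : ℝ => -(r * s₀ * x)) (-(1 * s₀ * x)) 0 :=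
          (((hasDerivAt_id (0 : ℝ)).mul_const s₀).mul_const x).neg
        have := this.exp
        simpa using this
      have h1 := hd.tendsto_slope_zero
      have h2 : Tendsto t atTop (𝓝[≠] 0) :=
        tendsto_nhdsWithin_iff.2 ⟨htlim, Eventually.of_forall fun n => (ht0 n).ne'⟩
      refine (h1.comp h2).congr fun n => ?_
      simp [div_eq_inv_mul]
  have hneg : ∫ q, -(s₀ * envX q) ∂ν < 0 := by
    rw [integral_neg, integral_const_mul]
    have := mul_pos hs₀ hEX
    linarith
  obtain ⟨n, hn⟩ := (hlim.eventually (gt_mem_nhds hneg)).exists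
  refine ⟨t n * s₀, mul_pos (ht0 n) hs₀, hi n, ?_⟩
  rw [integral_div, integral_sub (hi n) (integrable_const 1)] at hn
  have := (div_lt_iff₀ (ht0 n)).1 hn
  simp at this
  exact this

lemma Phi_int {ν : Measure (ℕ → ℝ)} [IsProbabilityMeasure ν]
    (hpmf : ∀ᵐ q ∂ν, IsPMF q) {γ : ℝ} (hγ : 0 < γ) (hA1 : ∀ᵐ q ∂ν, q 0 < 1 - γ)
    {s : ℝ} (hs : 0 < s) (hint : Integrable (fun q => Real.exp (-(s * envX q))) ν)
    (hlt : ∫ q, Real.exp (-(s * envX q)) ∂ν < 1) :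
    ∃ r : ℝ, 0 < r ∧ r < 1 ∧ ∃ K : ℕ, 1 ≤ K ∧ ∀ k : ℕ, K ≤ k →
      ∫⁻ q, ENNReal.ofReal (Phi s k q) ∂ν ≤ ENNReal.ofReal r := by
  have hA1' : ∀ᵐ q ∂ν, q 0 < 1 - min γ 1 := by
    filter_upwards [hA1] with q hq
    linarith [min_le_left γ 1]
  obtain ⟨C, hC⟩ := Phi_bdd (γ := min γ 1) (s := s) (by positivity) (min_le_right _ _) hs
  have hmeas : ∀ k, AEStronglyMeasurable (fun q => max (Phi s k q) (Real.exp (-(s * envX q)))) ν :=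
    fun k => (Phi_measurable s k).aestronglyMeasurable.sup hint.1
  have hbd : Integrable (fun q => |C| + Real.exp (-(s * envX q))) ν :=
    (integrable_const _).add hint
  have hdom : ∀ k, 1 ≤ k → ∀ᵐ q ∂ν, ‖max (Phi s k q) (Real.exp (-(s * envX q)))‖ ≤
      |C| + Real.exp (-(s * envX q)) := by
    intro k hk
    filter_upwards [hpmf, hA1'] with q h1 h2
    have h3 := hC q h1 h2 k hk
    have h4 := Real.exp_pos (-(s * envX q))
    rw [Real.norm_eq_abs, abs_of_nonneg (le_max_of_le_right h4.le)]
    exact max_le (by linarith [le_abs_self C]) (by linarith [abs_nonneg C])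
  have hlim : Tendsto (fun k => ∫ q, max (Phi s k q) (Real.exp (-(s * envX q))) ∂ν) atTop
      (𝓝 (∫ q, Real.exp (-(s * envX q)) ∂ν)) := by
    refine tendsto_integral_filter_of_dominated_convergence
      (fun q => |C| + Real.exp (-(s * envX q))) (Eventually.of_forall hmeas) ?_ hbd ?_
    · filter_upwards [eventually_ge_atTop 1] with k hk using hdom k hk
    · filter_upwards [hpmf, hA1] with q h1 h2
      refine tendsto_order.2 ⟨fun b hb => ?_, fun b hb => ?_⟩
      · exact Eventually.of_forall fun k => lt_max_of_lt_right hb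
      · filter_upwards [Phi_eventually h1 (by linarith) hs hb] with k hk
        exact max_lt hk hb
  obtain ⟨r, hr1, hr2⟩ := exists_between hlt
  have hr0 : 0 < r := lt_of_le_of_lt (integral_nonneg fun q => (Real.exp_pos _).le) hr1
  obtain ⟨K, hK⟩ := eventually_atTop.1 (hlim.eventually (gt_mem_nhds hr1))
  refine ⟨r, hr0, hr2, max K 1, le_max_right _ _, fun k hk => ?_⟩
  have hk1 : 1 ≤ k := (le_max_right _ _).trans hk
  have hI : Integrable (fun q => max (Phi s k q) (Real.exp (-(s * envX q)))) ν :=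
    hbd.mono' (hmeas k) (hdom k hk1)
  calc ∫⁻ q, ENNReal.ofReal (Phi s k q) ∂ν
      ≤ ∫⁻ q, ENNReal.ofReal (max (Phi s k q) (Real.exp (-(s * envX q)))) ∂ν :=
        lintegral_mono fun q => ENNReal.ofReal_le_ofReal (le_max_left _ _)
    _ = ENNReal.ofReal (∫ q, max (Phi s k q) (Real.exp (-(s * envX q))) ∂ν) :=
        (ofReal_integral_eq_lintegral_ofReal hI
          (Eventually.of_forall fun q => le_max_of_le_right (Real.exp_pos _).le)).symm
    _ ≤ _ := ENNReal.ofReal_le_ofReal (hK k ((le_max_left _ _).trans hk)).le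

lemma kap_pos {ν : Measure (ℕ → ℝ)} {i j : ℕ} (S : Set (ℕ → ℝ)) (hS : 0 < ν S)
    (h : ∀ᵐ q ∂ν, q ∈ S → 0 < convPow q i j) : 0 < kap ν i j := by
  unfold kap
  rw [pos_iff_ne_zero]
  intro h0
  rw [lintegral_eq_zero_iff (convPow_measurable i j).ennreal_ofReal] at h0
  refine hS.ne' ?_
  have : ∀ᵐ q ∂ν, q ∉ S := by
    filter_upwards [h0, h] with q h1 h2 h3
    have := h2 h3
    simp only [Pi.zero_apply, ENNReal.ofReal_eq_zero] at h1
    linarith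
  exact measure_eq_zero_iff_ae_notMem.2 this

lemma sum_kap {ν : Measure (ℕ → ℝ)} (i : ℕ) (H : ℕ → ℝ≥0∞) :
    ∑' j, kap ν i j * H j = ∫⁻ q, ∑' j, ENNReal.ofReal (convPow q i j) * H j ∂ν := by
  rw [lintegral_tsum fun j => ((convPow_measurable i j).ennreal_ofReal.mul_const _).aemeasurable]
  refine tsum_congr fun j => ?_
  rw [lintegral_mul_const _ (convPow_measurable i j).ennreal_ofReal, kap]

lemma lyapunov {ν : Measure (ℕ → ℝ)} [IsProbabilityMeasure ν]
    (hpmf : ∀ᵐ q ∂ν, IsPMF q) (hq0 : 0 < ν {q | 0 < q 0})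
    {s : ℝ} (hs : 0 < s) {r : ℝ} (hr1 : r < 1) {K : ℕ} (hK : 1 ≤ K)
    (hPhi : ∀ k : ℕ, K ≤ k → ∫⁻ q, ENNReal.ofReal (Phi s k q) ∂ν ≤ ENNReal.ofReal r) :
    ∃ R : ℝ≥0∞, R < 1 ∧ ∃ H : ℕ → ℝ≥0∞, (∀ j, H j ≤ 1) ∧ (∀ j, 1 ≤ j → 0 < H j) ∧
      ∀ i, ∑' j, kap ν i j * H j ≤ R * H i := by
  have hK0 : (0 : ℝ) < K := by exact_mod_cast hK
  have hδ : 0 < kap ν K 0 := by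
    refine kap_pos _ hq0 (Eventually.of_forall fun q hq => ?_)
    rw [convPow_zero_right]
    exact pow_pos hq _
  have hH0 : ENNReal.ofReal (min 1 ((K : ℝ) ^ s * Wt s 0)) = 0 := by simp [Wt]
  refine ⟨max (ENNReal.ofReal r) (1 - kap ν K 0), max_lt ?_ ?_,
    fun j => ENNReal.ofReal (min 1 ((K : ℝ) ^ s * Wt s j)), fun j => ?_, fun j hj => ?_,
    fun i => ?_⟩
  · simpa using hr1
  · exact ENNReal.sub_lt_self ENNReal.one_ne_top one_ne_zero hδ.ne'
  · rw [← ENNReal.ofReal_one]; exact ENNReal.ofReal_le_ofReal (min_le_left _ _)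
  · rw [ENNReal.ofReal_pos]
    have : (0 : ℝ) < j := by exact_mod_cast hj
    have hj0 : j ≠ 0 := by omega
    refine lt_min one_pos ?_
    simp only [Wt, hj0, if_false]
    positivity
  · beta_reduce
    rcases Nat.eq_zero_or_pos i with rfl | hi
    · rw [hH0, mul_zero]
      refine le_of_eq (ENNReal.tsum_eq_zero.2 fun j => ?_)
      by_cases hj : j = 0
      · subst hj; rw [hH0, mul_zero]
      · simp [kap, convPow, hj]
    have hi0 : (0 : ℝ) < i := by exact_mod_cast hi
    have hWi : Wt s i = (i : ℝ) ^ (-s) := by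
      have : i ≠ 0 := by omega
      simp [Wt, this]
    rw [sum_kap]
    rcases le_or_gt K i with hKi | hKi
    · have hHi : min 1 ((K : ℝ) ^ s * Wt s i) = (K : ℝ) ^ s * Wt s i := by
        refine min_eq_right ?_
        rw [hWi, Real.rpow_neg hi0.le, ← div_eq_mul_inv]
        exact div_le_one_of_le₀ (Real.rpow_le_rpow hK0.le (by exact_mod_cast hKi) hs.le)
          (by positivity)
      rw [hHi]
      have hc : 0 ≤ (K : ℝ) ^ s * Wt s i := mul_nonneg (by positivity) (Wt_nonneg _ _)
      calc ∫⁻ q, ∑' j, ENNReal.ofReal (convPow q i j) *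
              ENNReal.ofReal (min 1 ((K : ℝ) ^ s * Wt s j)) ∂ν
          ≤ ∫⁻ q, ENNReal.ofReal ((K : ℝ) ^ s * Wt s i) * ENNReal.ofReal (Phi s i q) ∂ν := by
            refine lintegral_mono_ae ?_
            filter_upwards [hpmf] with q h
            rw [← ENNReal.ofReal_mul hc]
            have e : (K : ℝ) ^ s * Wt s i * Phi s i q =
                ∑' j, convPow q i j * ((K : ℝ) ^ s * Wt s j) := by
              have e1 : (i : ℝ) ^ (-s) * (i : ℝ) ^ s = 1 := by
                rw [← Real.rpow_add hi0]; simp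
              rw [Phi, hWi]
              calc _ = (K : ℝ) ^ s * ((i : ℝ) ^ (-s) * (i : ℝ) ^ s) *
                    ∑' j, convPow q i j * Wt s j := by ring
                _ = _ := by
                  rw [e1, mul_one, ← tsum_mul_left]
                  exact tsum_congr fun j => by ring
            rw [e, ENNReal.ofReal_tsum_of_nonneg]
            · refine ENNReal.tsum_le_tsum fun j => ?_
              rw [ENNReal.ofReal_mul (convPow_nonneg h.1 i j)]
              exact mul_le_mul_right (ENNReal.ofReal_le_ofReal (min_le_right _ _)) _
            · exact fun j => mul_nonneg (convPow_nonneg h.1 i j)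
                (mul_nonneg (by positivity) (Wt_nonneg _ _))
            · refine ((summable_Wt h hs i).mul_left ((K : ℝ) ^ s)).congr fun j => by ring
        _ = ENNReal.ofReal ((K : ℝ) ^ s * Wt s i) * ∫⁻ q, ENNReal.ofReal (Phi s i q) ∂ν :=
            lintegral_const_mul _ (Phi_measurable s i).ennreal_ofReal
        _ ≤ ENNReal.ofReal ((K : ℝ) ^ s * Wt s i) * ENNReal.ofReal r :=
            mul_le_mul_right (hPhi i hKi) _
        _ ≤ _ := by
            rw [mul_comm]
            exact mul_le_mul_left (le_max_left _ _) _
    · have hHi : min 1 ((K : ℝ) ^ s * Wt s i) = 1 := by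
        refine min_eq_left ?_
        rw [hWi, Real.rpow_neg hi0.le, ← div_eq_mul_inv, one_le_div (by positivity)]
        exact Real.rpow_le_rpow hi0.le (by exact_mod_cast hKi.le) hs.le
      rw [hHi, ENNReal.ofReal_one, mul_one]
      refine le_trans ?_ (le_max_right _ _)
      have hfin : kap ν K 0 ≠ ∞ := by
        refine ne_top_of_le_ne_top (b := ∫⁻ _, 1 ∂ν) (by simp) (lintegral_mono_ae ?_)
        filter_upwards [hpmf] with q h
        rw [← tsum_ofReal_convPow h K]
        exact ENNReal.le_tsum 0
      refine ENNReal.le_sub_of_add_le_right hfin ?_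
      have hle : kap ν K 0 ≤ ∫⁻ q, ENNReal.ofReal (convPow q i 0) ∂ν := by
        refine lintegral_mono_ae ?_
        filter_upwards [hpmf] with q h
        refine ENNReal.ofReal_le_ofReal ?_
        rw [convPow_zero_right, convPow_zero_right]
        refine pow_le_pow_of_le_one (h.1 0) ?_ hKi.le
        have := h.summable.le_tsum 0 (fun j _ => h.1 j)
        rwa [h.2] at this
      refine (add_le_add_right hle _).trans ?_
      rw [← lintegral_add_right _ (convPow_measurable i 0).ennreal_ofReal]
      calc _ ≤ ∫⁻ _, 1 ∂ν := by
            refine lintegral_mono_ae ?_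
            filter_upwards [hpmf] with q h
            rw [← tsum_ofReal_convPow h i]
            rw [ENNReal.tsum_eq_add_tsum_ite 0, hH0, mul_zero, zero_add,
              ENNReal.tsum_eq_add_tsum_ite (f := fun j => ENNReal.ofReal (convPow q i j)) 0,
              add_comm]
            refine add_le_add_right (ENNReal.tsum_le_tsum fun j => ?_) _
            split_ifs
            · exact le_rfl
            · refine mul_le_of_le_one_right' ?_
              rw [← ENNReal.ofReal_one]; exact ENNReal.ofReal_le_ofReal (min_le_left _ _)
        _ = 1 := by simp

lemma kapN_le {ν : Measure (ℕ → ℝ)} {R : ℝ≥0∞} {H : ℕ → ℝ≥0∞}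
    (h : ∀ i, ∑' j, kap ν i j * H j ≤ R * H i) (n k : ℕ) :
    ∑' j, kapN ν n k j * H j ≤ R ^ n * H k := by
  induction n with
  | zero => simp [kapN]
  | succ n ih =>
    calc ∑' j, kapN ν (n + 1) k j * H j
        = ∑' i, kapN ν n k i * ∑' j, kap ν i j * H j := by
          simp only [kapN, ← ENNReal.tsum_mul_left, ← ENNReal.tsum_mul_right]
          rw [ENNReal.tsum_comm]
          simp only [mul_assoc]
      _ ≤ ∑' i, kapN ν n k i * (R * H i) :=
          ENNReal.tsum_le_tsum fun i => mul_le_mul_right (h i) _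
      _ = R * ∑' i, kapN ν n k i * H i := by
          rw [← ENNReal.tsum_mul_left]
          exact tsum_congr fun i => by ring
      _ ≤ R * (R ^ n * H k) := mul_le_mul_right ih _
      _ = _ := by rw [pow_succ]; ring

lemma kapN_pos {ν : Measure (ℕ → ℝ)} {z : ℕ} (h : 0 < kap ν z z) (n : ℕ) :
    0 < kapN ν n z z := by
  induction n with
  | zero => simp [kapN]
  | succ n ih =>
    simp only [kapN]
    exact (ENNReal.mul_pos ih.ne' h.ne').trans_le
      (ENNReal.le_tsum (f := fun i => kapN ν n z i * kap ν i z) z)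

/-- Proposition 2.2 (i). Under `E[X] > 0`, `P₁(Z₁ = 0) > 0`,
`E[e^{-sX}] < ∞` for some `s > 0` and Assumption A1 (`Q(0) < 1 - γ` a.s. for some `γ > 0`
and `E[|X|] < ∞`), the rate `ρ = -lim (1/n) log P_{z₀}(Z_n = z₀)` is positive. -/
theorem stmt4 (ν : Measure (ℕ → ℝ)) [IsProbabilityMeasure ν]
    (hpmf : ∀ᵐ q ∂ν, IsPMF q)
    (hXint : Integrable envX ν)
    (hEX : 0 < ∫ q, envX q ∂ν)
    (hext : 0 < aP ν 1 1 0)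
    (hexp : ∃ s : ℝ, 0 < s ∧ Integrable (fun q => Real.exp (-(s * envX q))) ν)
    (hA1 : ∃ γ : ℝ, 0 < γ ∧ ∀ᵐ q ∂ν, q 0 < 1 - γ)
    (z₀ : ℕ) (hz₀ : z₀ ∈ Iset ν ∧ ∀ j ∈ Iset ν, z₀ ≤ j)
    (ρ : ℝ)
    (hρ : Tendsto (fun n : ℕ => (1 / (n : ℝ)) * Real.log (aP ν n z₀ z₀)) atTop (𝓝 (-ρ))) :
    0 < ρ := by
  obtain ⟨γ, hγ, hA⟩ := hA1
  obtain ⟨s, hs, hint, hlt⟩ := exists_s hXint hEX hexp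
  obtain ⟨r, hr0, hr1, K, hK, hPhi⟩ := Phi_int hpmf hγ hA hs hint hlt
  obtain ⟨⟨hz1, hzpos⟩, -⟩ := hz₀
  have hq0 : 0 < ν {q | 0 < q 0} := hzpos.trans_le (measure_mono fun q hq => hq.2)
  obtain ⟨R, hR1, H, hH1, hHpos, hstep⟩ := lyapunov hpmf hq0 hs hr1 hK hPhi
  have hkz : 0 < kap ν z₀ z₀ := by
    refine kap_pos _ hzpos ?_
    filter_upwards [hpmf] with q h hq
    exact convPow_pos h.1 hz1 hq.1 hq.2
  have hbound : ∀ n, kapN ν n z₀ z₀ ≤ R ^ n := by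
    intro n
    have h1 : kapN ν n z₀ z₀ * H z₀ ≤ R ^ n * H z₀ :=
      (ENNReal.le_tsum (f := fun j => kapN ν n z₀ j * H j) z₀).trans (kapN_le hstep n z₀)
    have h2 : H z₀ ≠ ⊤ := ne_top_of_le_ne_top ENNReal.one_ne_top (hH1 z₀)
    exact (ENNReal.mul_le_mul_iff_left (hHpos z₀ hz1).ne' h2).1 h1
  have hRt : R ≠ ⊤ := (hR1.trans ENNReal.one_lt_top).ne
  have hapos : ∀ n, 0 < aP ν n z₀ z₀ := by
    intro n
    rw [aP_eq ν hpmf]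
    exact ENNReal.toReal_pos (kapN_pos hkz n).ne'
      (ne_top_of_le_ne_top (ENNReal.pow_ne_top hRt) (hbound n))
  have haP : ∀ n, aP ν n z₀ z₀ ≤ R.toReal ^ n := by
    intro n
    rw [aP_eq ν hpmf, ← ENNReal.toReal_pow]
    exact ENNReal.toReal_mono (ENNReal.pow_ne_top hRt) (hbound n)
  have hR0 : 0 < R.toReal := by
    have h1 := haP 1
    rw [pow_one] at h1
    exact (hapos 1).trans_le h1
  have hlog : Real.log R.toReal < 0 := by
    refine Real.log_neg hR0 ?_
    rw [← ENNReal.toReal_one]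
    exact (ENNReal.toReal_lt_toReal hRt ENNReal.one_ne_top).2 hR1
  have hle : -ρ ≤ Real.log R.toReal := by
    refine le_of_tendsto hρ ?_
    filter_upwards [eventually_ge_atTop 1] with n hn
    have hn0 : (0 : ℝ) < n := by exact_mod_cast hn
    have h1 := Real.log_le_log (hapos n) (haP n)
    rw [Real.log_pow] at h1
    rw [one_div, inv_mul_le_iff₀ hn0]
    exact h1
  linarith

end
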